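/- (Taylor expansion at 0) For every F ∈ ℛ[r], F = Σ_{k ≥ 0} Σ_{a₁,…,a_k ∈ L} ι[(∂/∂a₁ ⋯ ∂/∂a_k F)(0)] · ((a₁,…,a_k)⊗∅), where only finitely many summands are nonzero. -/

import Mathlib

/-- All shuffles (interleavings) of two lists. -/
def shuffles {α : Type*} : List α → List α → List (List α)
  | [], ys => [ys]
  | x :: xs, [] => [x :: xs]
  | x :: xs, y :: ys =>
      ((shuffles xs (y :: ys)).map (x :: ·)) ++ ((shuffles (x :: xs) ys).map (y :: ·))
  termination_by xs ys => xs.length + ys.length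

/-- `ℛ`: the free `ℤ`-module on finite sequences of labels. -/
abbrev CalcR (L : Type) := List L →₀ ℤ

/-- `ℛ[r]`: the free `ℤ`-module on the elements `A ⊗ B`, encoded as pairs of sequences. -/
abbrev CalcRr (L : Type) := (List L × List L) →₀ ℤ

/-- The shuffle product of two basis sequences. -/
noncomputable def shuffleBase {L : Type} (A B : List L) : CalcR L :=
  ((shuffles A B).map fun s => Finsupp.single s (1 : ℤ)).sum

/-- The shuffle product on `ℛ`. -/
noncomputable def rmul {L : Type} (X Y : CalcR L) : CalcR L :=
  X.sum fun A cA => Y.sum fun B cB => (cA * cB) • shuffleBase A B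

/-- The unit `∅` of `ℛ`. -/
noncomputable def rone (L : Type) : CalcR L := Finsupp.single [] 1

/-- The product `(A⊗B)(C⊗D) = (AC)⊗(BD)` of two basis elements of `ℛ[r]`. -/
noncomputable def pairBase {L : Type} (p q : List L × List L) : CalcRr L :=
  ((shuffles p.1 q.1).flatMap fun s =>
    (shuffles p.2 q.2).map fun t => Finsupp.single (s, t) (1 : ℤ)).sum

/-- The product on `ℛ[r]`. -/
noncomputable def pmul {L : Type} (X Y : CalcRr L) : CalcRr L :=
  X.sum fun p c => Y.sum fun q d => (c * d) • pairBase p q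

/-- The unit `∅ ⊗ ∅` of `ℛ[r]`. -/
noncomputable def pone (L : Type) : CalcRr L := Finsupp.single ([], []) 1

/-- The derivative `∂/∂a` on `ℛ[r]`. -/
noncomputable def pderiv {L : Type} [DecidableEq L] (a : L) (X : CalcRr L) : CalcRr L :=
  X.sum fun p c => c •
    ((if p.1.getLast? = some a then Finsupp.single (p.1.dropLast, p.2) (1 : ℤ) else 0) -
     (if p.2.head? = some a then Finsupp.single (p.1, p.2.tail) (1 : ℤ) else 0))

/-- The embedding `ι : ℛ → ℛ[r]`, `ι(a₁,…,a_n) = Σ_k (a₁,…,a_k) ⊗ (a_{k+1},…,a_n)`. -/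
noncomputable def iotaR {L : Type} (C : CalcR L) : CalcRr L :=
  C.sum fun A c => c • (((List.range (A.length + 1)).map fun k =>
    Finsupp.single (A.take k, A.drop k) (1 : ℤ)).sum)

/-- The value at `0`: `(A⊗B)(0) = B` if `A = ∅` and `0` otherwise. -/
noncomputable def ev0 {L : Type} [DecidableEq L] (X : CalcRr L) : CalcR L :=
  X.sum fun p c => if p.1 = [] then Finsupp.single p.2 c else 0

/-- The value at `1`: `(A⊗B)(1) = A` if `B = ∅` and `0` otherwise. -/
noncomputable def ev1 {L : Type} [DecidableEq L] (X : CalcRr L) : CalcR L :=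
  X.sum fun p c => if p.2 = [] then Finsupp.single p.1 c else 0

/-- The integral `∫₀^# · da` on `ℛ[r]`. -/
noncomputable def integ0 {L : Type} (a : L) (X : CalcRr L) : CalcRr L :=
  X.sum fun p c => c • (((List.range (p.2.length + 1)).map fun k =>
    Finsupp.single (p.1 ++ a :: p.2.take k, p.2.drop k) (1 : ℤ)).sum)

/-- Iterated derivative `∂/∂a₁ ⋯ ∂/∂a_k` along a list `(a₁, …, a_k)`. -/
noncomputable def derivs {L : Type} [DecidableEq L] : List L → CalcRr L → CalcRr L
  | [], F => F
  | a :: w, F => pderiv a (derivs w F)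

namespace TaylorAux

/-- Sum of `f U w` over all ways of splitting `S` into complementary subsequences `U`, `w`. -/
def spsum {L : Type} : List L → (List L → List L → ℤ) → ℤ
  | [], f => f [] []
  | s :: S, f => spsum S (fun U w => f (s :: U) w) + spsum S (fun U w => f U (s :: w))

theorem spsum_append {L : Type} (a : L) (S : List L) : ∀ f : List L → List L → ℤ,
    spsum (S ++ [a]) f =
      spsum S (fun U w => f (U ++ [a]) w) + spsum S (fun U w => f U (w ++ [a])) := by
  induction S with
  | nil => intro f; simp [spsum]
  | cons s S ih =>
    intro f
    simp only [List.cons_append, spsum, ih]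
    ring

theorem spsum_add {L : Type} (S : List L) : ∀ f g : List L → List L → ℤ,
    spsum S (fun U w => f U w + g U w) = spsum S f + spsum S g := by
  induction S with
  | nil => intro f g; simp [spsum]
  | cons s S ih =>
    intro f g
    simp only [spsum, ih]
    ring

theorem spsum_mul {L : Type} (S : List L) (c : ℤ) : ∀ f : List L → List L → ℤ,
    spsum S (fun U w => c * f U w) = c * spsum S f := by
  induction S with
  | nil => intro f; simp [spsum]
  | cons s S ih =>
    intro f
    simp only [spsum, ih]
    ring

theorem spsum_zero {L : Type} (S : List L) :
    spsum S (fun _ _ => 0) = 0 := by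
  induction S with
  | nil => simp [spsum]
  | cons s S ih => simp only [spsum, ih]; rfl

theorem spsum_sum {L ι : Type} (S : List L) (t : Finset ι) (f : ι → List L → List L → ℤ) :
    spsum S (fun U w => ∑ i ∈ t, f i U w) = ∑ i ∈ t, spsum S (f i) := by
  classical
  induction t using Finset.induction_on with
  | empty => simp [spsum_zero]
  | insert i t hi ih => simp only [Finset.sum_insert hi, spsum_add, ih]

theorem count_shuffles {L : Type} [DecidableEq L] (S : List L) : ∀ A w : List L,
    ((shuffles A w).count S : ℤ) = spsum S (fun U v => if U = A ∧ v = w then 1 else 0) := by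
  induction S with
  | nil =>
    intro A w
    cases A with
    | nil => cases w <;> simp [shuffles, spsum]
    | cons x A =>
      cases w with
      | nil => simp [shuffles, spsum]
      | cons y w => 
        have hk : ∀ (z : L) (l : List (List L)), (l.map (z :: ·)).count [] = 0 := by
          intro z l
          apply List.count_eq_zero_of_not_mem
          simp
        rw [shuffles, List.count_append, hk, hk]
        simp [spsum]
  | cons s S ih =>
    have key : ∀ (x : L) (l : List (List L)),
        (l.map (x :: ·)).count (s :: S) = if x = s then l.count S else 0 := by
      intro x l
      induction l with
      | nil => simp
      | cons b l ihl =>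
        simp only [List.map_cons, List.count_cons, ihl]
        by_cases h : x = s <;> simp [h]
    intro A w
    cases A with
    | nil =>
      cases w with
      | nil => simp [shuffles, spsum, spsum_zero]
      | cons y w =>
        have h1 := ih [] w
        simp only [shuffles, spsum, List.count_singleton, List.cons.injEq, reduceCtorEq, false_and,
          if_false, spsum_zero, zero_add, beq_iff_eq] at h1 ⊢
        by_cases h : y = s
        · subst h; simpa using h1
        · simp [h, Ne.symm h, spsum_zero]
    | cons x A =>
      cases w with
      | nil =>
        have h1 := ih A []
        have h2 : shuffles A ([] : List L) = [A] := by cases A <;> simp [shuffles]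
        simp only [h2, shuffles, spsum, List.count_singleton, List.cons.injEq, reduceCtorEq,
          and_false, if_false, spsum_zero, add_zero, beq_iff_eq] at h1 ⊢
        by_cases h : x = s
        · subst h; simpa using h1
        · simp [h, Ne.symm h, spsum_zero]
      | cons y w =>
        have h1 := ih A (y :: w)
        have h2 := ih (x :: A) w
        rw [shuffles, List.count_append, key, key]
        simp only [spsum, List.cons.injEq]
        push_cast
        rw [h1, h2]
        congr 1
        · by_cases h : x = s
          · subst h; simp
          · simp [h, Ne.symm h, spsum_zero]
        · by_cases h : y = s
          · subst h; simp
          · simp [h, Ne.symm h, spsum_zero]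

theorem sum_single_apply {α : Type} [BEq α] [LawfulBEq α] (l : List α) (x : α) :
    ((l.map fun s => Finsupp.single s (1 : ℤ)).sum) x = (l.count x : ℤ) := by
  classical
  induction l with
  | nil => simp
  | cons b l ih =>
    simp only [List.map_cons, List.sum_cons, Finsupp.add_apply, ih, List.count_cons,
      Finsupp.single_apply]
    by_cases h : b = x <;> simp [h, add_comm]

theorem pairBase_apply {L : Type} [DecidableEq L] (p : List L × List L) (w S T : List L) :
    pairBase p (w, []) (S, T) =
      spsum S (fun U v => if v = w then (Finsupp.single p (1 : ℤ)) (U, T) else 0) := by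
  obtain ⟨A, B⟩ := p
  have h2 : shuffles B ([] : List L) = [B] := by cases B <;> simp [shuffles]
  have h3 : pairBase (A, B) (w, []) =
      (((shuffles A w).map fun s => (s, B)).map fun q => Finsupp.single q (1 : ℤ)).sum := by
    simp only [pairBase, h2, List.map_map]
    congr 1
    simp [List.flatMap_def, Function.comp_def]
    generalize shuffles A w = l
    induction l with
    | nil => simp
    | cons b l ih => simp [ih]
  rw [h3, sum_single_apply]
  have h4 : ((shuffles A w).map fun s => (s, B)).count (S, T) =
      if B = T then (shuffles A w).count S else 0 := by
    generalize shuffles A w = l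
    induction l with
    | nil => simp
    | cons b l ih =>
      simp only [List.map_cons, List.count_cons, ih]
      by_cases h : B = T <;> simp [h]
  rw [h4]
  by_cases h : B = T
  · subst h
    rw [if_pos rfl, count_shuffles]
    congr 1
    funext U v
    by_cases hv : v = w <;> simp [hv, Finsupp.single_apply, eq_comm]
  · simp [h, Finsupp.single_apply, spsum_zero]

theorem pmul_apply {L : Type} [DecidableEq L] (X : CalcRr L) (w S T : List L) :
    pmul X (Finsupp.single (w, []) (1 : ℤ)) (S, T) =
      spsum S (fun U v => if v = w then X (U, T) else 0) := by
  have h1 : ∀ U v, (if v = w then X (U, T) else 0) = ∑ p ∈ X.support,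
      X p * (if v = w then (Finsupp.single p (1 : ℤ)) (U, T) else 0) := by
    intro U v
    by_cases hv : v = w
    · simp [hv, Finsupp.single_apply]
    · simp [hv]
  simp only [h1]
  rw [spsum_sum]
  simp only [spsum_mul, ← pairBase_apply]
  simp [pmul, Finsupp.sum, Finsupp.finsetSum_apply]

theorem iotaR_apply {L : Type} [DecidableEq L] (C : CalcR L) (U T : List L) :
    iotaR C (U, T) = C (U ++ T) := by
  have h : ∀ A : List L, (((List.range (A.length + 1)).map fun k =>
      Finsupp.single (A.take k, A.drop k) (1 : ℤ)).sum) (U, T) = if A = U ++ T then 1 else 0 := by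
    intro A
    have := sum_single_apply ((List.range (A.length + 1)).map fun k => (A.take k, A.drop k)) (U, T)
    rw [List.map_map] at this
    refine Eq.trans this ?_
    have hnd : ((List.range (A.length + 1)).map fun k => (A.take k, A.drop k)).Nodup := by
      refine List.Nodup.map_on ?_ List.nodup_range
      intro x hx y hy hxy
      have := congrArg (fun q => q.1.length) hxy
      simp at this hx hy
      omega
    by_cases hA : A = U ++ T
    · subst hA
      rw [if_pos rfl, List.count_eq_one_of_mem hnd]
      · rfl
      · refine List.mem_map.2 ⟨U.length, ?_, ?_⟩
        · simp
        · simp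
    · rw [if_neg hA, List.count_eq_zero_of_not_mem]
      · rfl
      · rintro hm
        obtain ⟨k, -, hk⟩ := List.mem_map.1 hm
        simp only [Prod.mk.injEq] at hk
        apply hA
        rw [← hk.1, ← hk.2, List.take_append_drop]
  simp only [iotaR, Finsupp.sum, Finsupp.finsetSum_apply, Finsupp.smul_apply, h]
  simp +contextual [eq_comm]

theorem ev0_apply {L : Type} [DecidableEq L] (X : CalcRr L) (B : List L) :
    ev0 X B = X ([], B) := by
  have h : ∀ p : List L × List L, (if p.1 = [] then Finsupp.single p.2 (X p) else 0) B =
      if p = ([], B) then X p else 0 := by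
    rintro ⟨A, D⟩
    by_cases hA : A = [] <;> simp [hA, Finsupp.single_apply]
  simp only [ev0, Finsupp.sum, Finsupp.finsetSum_apply, h]
  simp [eq_comm]

theorem pderiv_apply {L : Type} [DecidableEq L] (a : L) (X : CalcRr L) (C D : List L) :
    pderiv a X (C, D) = X (C ++ [a], D) - X (C, a :: D) := by
  have h1 : ∀ p : List L × List L,
      (if p.1.getLast? = some a then Finsupp.single (p.1.dropLast, p.2) (1 : ℤ) else 0) (C, D) =
      if p = (C ++ [a], D) then 1 else 0 := by
    rintro ⟨A, B⟩
    rcases List.eq_nil_or_concat A with rfl | ⟨A', x, rfl⟩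
    · simp
    · by_cases hx : x = a
      · simp [hx, Finsupp.single_apply]
      · simp [hx]
  have h2 : ∀ p : List L × List L,
      (if p.2.head? = some a then Finsupp.single (p.1, p.2.tail) (1 : ℤ) else 0) (C, D) =
      if p = (C, a :: D) then 1 else 0 := by
    rintro ⟨A, B⟩
    cases B with
    | nil => simp
    | cons x B =>
      by_cases hx : x = a
      · simp [hx, Finsupp.single_apply]
      · simp [hx]
  simp only [pderiv, Finsupp.sum, Finsupp.finsetSum_apply, Finsupp.smul_apply,
    Finsupp.sub_apply, h1, h2, smul_sub, Finset.sum_sub_distrib]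
  simp only [smul_eq_mul, mul_ite, mul_one, mul_zero, Finset.sum_ite_eq', Finsupp.mem_support_iff]
  congr 1 <;> split_ifs with h <;> simp_all

theorem derivs_append {L : Type} [DecidableEq L] (a : L) (w : List L) (F : CalcRr L) :
    derivs (w ++ [a]) F = derivs w (pderiv a F) := by
  induction w with
  | nil => rfl
  | cons b w ih => simp [derivs, ih]

theorem main_coeff {L : Type} [DecidableEq L] (S : List L) : ∀ (F : CalcRr L) (T : List L),
    spsum S (fun U w => derivs w F ([], U ++ T)) = F (S, T) := by
  induction S using List.reverseRecOn with
  | nil => intro F T; simp [spsum, derivs]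
  | append_singleton S a ih =>
    intro F T
    rw [spsum_append]
    simp only [derivs_append, List.append_assoc, List.singleton_append]
    rw [ih F (a :: T), ih (pderiv a F) T, pderiv_apply]
    ring

theorem derivs_supp {L : Type} [DecidableEq L] (F : CalcRr L) (w : List L) : ∀ C D : List L,
    derivs w F (C, D) ≠ 0 → ∃ p ∈ F.support, (w ++ (C ++ D)).Perm (p.1 ++ p.2) := by
  induction w with
  | nil =>
    intro C D h
    exact ⟨(C, D), Finsupp.mem_support_iff.2 h, by simp⟩
  | cons a w ih =>
    intro C D h
    rw [derivs, pderiv_apply] at h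
    have e : (a :: w ++ (C ++ D)).Perm (w ++ (C ++ a :: D)) := by
      rw [← List.append_assoc w C (a :: D), ← List.append_assoc]
      exact (List.perm_middle (a := a) (l₁ := w ++ C) (l₂ := D)).symm
    by_cases h0 : derivs w F (C, a :: D) = 0
    · obtain ⟨p, hp, hq⟩ := ih (C ++ [a]) D (by intro h'; apply h; rw [h', h0]; rfl)
      refine ⟨p, hp, e.trans ?_⟩
      simpa using hq
    · obtain ⟨p, hp, hq⟩ := ih C (a :: D) h0
      exact ⟨p, hp, e.trans hq⟩

theorem finite_supp {L : Type} [DecidableEq L] (F : CalcRr L) :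
    {w : List L | ev0 (derivs w F) ≠ 0}.Finite := by
  refine Set.Finite.subset (F.support.biUnion fun p =>
    ((p.1 ++ p.2).sublists.flatMap List.permutations).toFinset).finite_toSet ?_
  intro w hw
  obtain ⟨V, hV⟩ := Finsupp.ne_iff.1 hw
  rw [ev0_apply] at hV
  obtain ⟨p, hp, hq⟩ := derivs_supp F w [] V hV
  have hs : List.Subperm w (p.1 ++ p.2) :=
    (List.sublist_append_left w ([] ++ V)).subperm.trans hq.subperm
  obtain ⟨l, hl, hl'⟩ := hs
  simp only [Finset.coe_biUnion, Set.mem_iUnion, Finset.mem_coe, List.mem_toFinset,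
    List.mem_flatMap, List.mem_sublists, List.mem_permutations]
  exact ⟨p, hp, l, hl', hl.symm⟩

end TaylorAux

open TaylorAux in
theorem taylor_at_zero (L : Type) [DecidableEq L] (F : CalcRr L) :
    F = ∑ᶠ w : List L,
      pmul (iotaR (ev0 (derivs w F))) (Finsupp.single (w, ([] : List L)) (1 : ℤ)) := by
  have hsub : (Function.support fun w : List L =>
      pmul (iotaR (ev0 (derivs w F))) (Finsupp.single (w, ([] : List L)) (1 : ℤ))) ⊆
      ((finite_supp F).toFinset : Set (List L)) := by
    intro w hw
    simp only [Set.Finite.coe_toFinset, Set.mem_ofPred_eq]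
    intro h
    apply hw
    simp [h, iotaR, pmul]
  rw [finsum_eq_sum_of_support_subset _ hsub]
  ext ⟨S, T⟩
  rw [Finsupp.finsetSum_apply]
  simp only [pmul_apply, iotaR_apply]
  rw [← spsum_sum, ← main_coeff S F T]
  congr 1
  funext U v
  rw [Finset.sum_ite_eq, ev0_apply]
  split_ifs with h
  · rfl
  · rw [Set.Finite.mem_toFinset, Set.mem_ofPred_eq, not_not] at h
    rw [← ev0_apply, h]
    rfl
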